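/- arXiv:2303.04570 — 5 statements merged into one kernel-verified Lean document; each statement's English description precedes it below -/
import Mathlib

section
/- Artin's theorem: let F_n be the free group on generators x_1,…,x_n. There is a group homomorphism A from the braid group B_n to the automorphism group of F_n determined on the generators by: A(σ_i) sends x_i ↦ x_i x_{i+1} x_i^{-1}, x_{i+1} ↦ x_i, and x_j ↦ x_j for j ≠ i, i+1. This homomorphism A is injective, i.e. the Artin action of B_n on F_n is faithful. -/
/-- The defining relations of the braid group with `m + 1` strands (`m` generators). -/
def braidRels (m : ℕ) : Set (FreeGroup (Fin m)) :=
  {r | (∃ i j : Fin m, (i : ℕ) + 2 ≤ (j : ℕ) ∧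
          r = FreeGroup.of i * FreeGroup.of j * (FreeGroup.of i)⁻¹ * (FreeGroup.of j)⁻¹) ∨
       (∃ i j : Fin m, (j : ℕ) = (i : ℕ) + 1 ∧
          r = FreeGroup.of i * FreeGroup.of j * FreeGroup.of i *
              (FreeGroup.of j * FreeGroup.of i * FreeGroup.of j)⁻¹)}

/-- The braid group `B_n` on `n` strands, presented with generators `σ_1, …, σ_{n-1}`
(indexed here by `Fin (n-1)`) and the braid relations. -/
abbrev BraidGroup (n : ℕ) : Type := PresentedGroup (braidRels (n - 1))

/-- The generator `σ_{i+1}` of the braid group `B_n` (0-based index `i : Fin (n-1)`). -/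
def braidGen (n : ℕ) (i : Fin (n - 1)) : BraidGroup n := PresentedGroup.of i

/-- The strand index `i` (lower strand of the generator `σ` with 0-based index `i`). -/
def strand₀ {n : ℕ} (i : Fin (n - 1)) : Fin n := ⟨i.val, by have := i.isLt; omega⟩

/-- The strand index `i + 1` (upper strand of the generator `σ` with 0-based index `i`). -/
def strand₁ {n : ℕ} (i : Fin (n - 1)) : Fin n := ⟨i.val + 1, by have := i.isLt; omega⟩
/-- `A` is the Artin action: the homomorphism `B_n → Aut(F_n)` determined on the
generators by `σ_i : x_i ↦ x_i x_{i+1} x_i⁻¹, x_{i+1} ↦ x_i, x_j ↦ x_j (j ≠ i, i+1)`. -/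
def IsArtinAction {n : ℕ} (A : BraidGroup n →* MulAut (FreeGroup (Fin n))) : Prop :=
  ∀ i : Fin (n - 1),
    A (braidGen n i) (FreeGroup.of (strand₀ i)) =
        FreeGroup.of (strand₀ i) * FreeGroup.of (strand₁ i) * (FreeGroup.of (strand₀ i))⁻¹ ∧
    A (braidGen n i) (FreeGroup.of (strand₁ i)) = FreeGroup.of (strand₀ i) ∧
    ∀ j : Fin n, j ≠ strand₀ i → j ≠ strand₁ i →
      A (braidGen n i) (FreeGroup.of j) = FreeGroup.of j

set_option linter.unusedSimpArgs false

namespace ArtinProof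

/-- The `i`-th free generator (trivial when out of range). -/
def X (n i : ℕ) : FreeGroup (Fin n) := if h : i < n then FreeGroup.of ⟨i, h⟩ else 1

/-- The `i`-th braid generator (trivial when out of range). -/
def S (m i : ℕ) : PresentedGroup (braidRels m) :=
  if h : i < m then PresentedGroup.of ⟨i, h⟩ else 1

lemma dec_ind {N : ℕ} {P : (k : ℕ) → k ≤ N → Prop} (self : P N le_rfl)
    (of_succ : ∀ k (hk : k < N), P (k + 1) hk → P k hk.le) (k : ℕ) (hk : k ≤ N) : P k hk :=
  Nat.decreasingInduction (motive := P) of_succ self hk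

lemma X_fin {n : ℕ} (j : Fin n) : FreeGroup.of j = X n j := by simp [X]

lemma S_fin {m : ℕ} (j : Fin m) :
    (PresentedGroup.of j : PresentedGroup (braidRels m)) = S m j := by simp [S]

lemma X_out {n i : ℕ} (h : n ≤ i) : X n i = 1 := by simp [X, not_lt.mpr h]

lemma S_out {n i : ℕ} (h : n ≤ i) : S n i = 1 := by simp [S, not_lt.mpr h]

lemma X_ne_one {n i : ℕ} (h : i < n) : X n i ≠ 1 := by
  simp only [X, h, dif_pos]
  exact FreeGroup.of_ne_one _

lemma hom_ext {n : ℕ} {G : Type*} [Group G] {f g : FreeGroup (Fin n) →* G}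
    (h : ∀ j, j < n → f (X n j) = g (X n j)) : f = g := by
  apply FreeGroup.ext_hom
  intro j
  rw [X_fin]
  exact h j j.2

lemma aut_ext {n : ℕ} {f g : MulAut (FreeGroup (Fin n))}
    (h : ∀ j, j < n → f (X n j) = g (X n j)) : f = g := by
  have : f.toMonoidHom = g.toMonoidHom := hom_ext h
  ext x
  exact DFunLike.congr_fun this x

lemma free_induction {n : ℕ} {P : FreeGroup (Fin n) → Prop} (h1 : P 1)
    (hX : ∀ j, j < n → P (X n j)) (hi : ∀ x, P x → P x⁻¹) (hm : ∀ x y, P x → P y → P (x * y))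
    (x : FreeGroup (Fin n)) : P x := by
  induction x using FreeGroup.induction_on with
  | C1 => exact h1
  | of j => rw [X_fin]; exact hX j j.2
  | inv_of j h => exact hi _ h
  | mul x y hx hy => exact hm _ _ hx hy

/-- lift of an `ℕ`-indexed family -/
def L (n : ℕ) {G : Type*} [Group G] (f : ℕ → G) : FreeGroup (Fin n) →* G :=
  FreeGroup.lift fun j => f j

lemma L_X {n : ℕ} {G : Type*} [Group G] (f : ℕ → G) {j : ℕ} (h : j < n) :
    L n f (X n j) = f j := by
  simp [L, X, h]

/-- The Artin endomorphism. -/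
def fwd (n i : ℕ) : FreeGroup (Fin n) →* FreeGroup (Fin n) :=
  L n fun j => if j = i then X n i * X n (i + 1) * (X n i)⁻¹ else if j = i + 1 then X n i else X n j

/-- Its inverse. -/
def bwd (n i : ℕ) : FreeGroup (Fin n) →* FreeGroup (Fin n) :=
  L n fun j => if j = i then X n (i + 1) else
    if j = i + 1 then (X n (i + 1))⁻¹ * X n i * X n (i + 1) else X n j

/-- The Artin automorphism. -/
def artin (n i : ℕ) (h : i + 1 < n) : MulAut (FreeGroup (Fin n)) :=
  MonoidHom.toMulEquiv (fwd n i) (bwd n i)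
    (by
      apply hom_ext
      intro j hj
      have hh : i < n := by omega
      by_cases h1 : j = i
      · subst h1; simp [fwd, bwd, L_X, h, hh, mul_assoc]
      · by_cases h2 : j = i + 1
        · subst h2; simp [fwd, bwd, L_X, h, hh]
        · simp [fwd, bwd, L_X, hj, h1, h2])
    (by
      apply hom_ext
      intro j hj
      have hh : i < n := by omega
      by_cases h1 : j = i
      · subst h1; simp [fwd, bwd, L_X, h, hh]
      · by_cases h2 : j = i + 1
        · subst h2; simp [fwd, bwd, L_X, h, hh, mul_assoc]
        · simp [fwd, bwd, L_X, hj, h1, h2])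

lemma artin_self {n i : ℕ} (h : i + 1 < n) :
    artin n i h (X n i) = X n i * X n (i + 1) * (X n i)⁻¹ := by
  have hh : i < n := by omega
  simp [artin, fwd, L_X, hh]

lemma artin_succ {n i : ℕ} (h : i + 1 < n) : artin n i h (X n (i + 1)) = X n i := by
  simp [artin, fwd, L_X, h]

lemma artin_other {n i j : ℕ} (h : i + 1 < n) (h1 : j ≠ i) (h2 : j ≠ i + 1) :
    artin n i h (X n j) = X n j := by
  by_cases hj : j < n
  · simp [artin, fwd, L_X, hj, h1, h2]
  · simp [X_out (not_lt.mp hj)]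

lemma artin_inv_self {n i : ℕ} (h : i + 1 < n) : (artin n i h)⁻¹ (X n i) = X n (i + 1) := by
  rw [MulAut.inv_apply, MulEquiv.symm_apply_eq, artin_succ]

lemma artin_inv_succ {n i : ℕ} (h : i + 1 < n) :
    (artin n i h)⁻¹ (X n (i + 1)) = (X n (i + 1))⁻¹ * X n i * X n (i + 1) := by
  rw [MulAut.inv_apply, MulEquiv.symm_apply_eq]
  simp [artin_succ, artin_self, mul_assoc]

lemma artin_comm {n i j : ℕ} (hi : i + 1 < n) (hj : j + 1 < n) (hij : i + 2 ≤ j) :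
    artin n i hi * artin n j hj = artin n j hj * artin n i hi := by
  apply aut_ext
  intro k hk
  simp only [MulAut.mul_apply]
  have e1 : artin n i hi (X n j) = X n j := artin_other _ (by omega) (by omega)
  have e2 : artin n i hi (X n (j + 1)) = X n (j + 1) := artin_other _ (by omega) (by omega)
  have e3 : artin n j hj (X n i) = X n i := artin_other _ (by omega) (by omega)
  have e4 : artin n j hj (X n (i + 1)) = X n (i + 1) := artin_other _ (by omega) (by omega)
  by_cases h1 : k = i
  · subst h1; simp [artin_self, artin_succ, e1, e2, e3, e4]
  by_cases h2 : k = i + 1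
  · subst h2; simp [artin_self, artin_succ, e1, e2, e3, e4]
  by_cases h3 : k = j
  · subst h3; simp [artin_self, artin_succ, e1, e2, e3, e4]
  by_cases h4 : k = j + 1
  · subst h4; simp [artin_self, artin_succ, e1, e2, e3, e4]
  simp [artin_other, h1, h2, h3, h4]

lemma artin_braid {n i : ℕ} (hi : i + 1 < n) (hj : i + 1 + 1 < n) :
    artin n i hi * artin n (i + 1) hj * artin n i hi =
      artin n (i + 1) hj * artin n i hi * artin n (i + 1) hj := by
  apply aut_ext
  intro k hk
  simp only [MulAut.mul_apply]
  have e1 : artin n (i + 1) hj (X n i) = X n i := artin_other _ (by omega) (by omega)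
  have e2 : artin n i hi (X n (i + 1 + 1)) = X n (i + 1 + 1) :=
    artin_other _ (by omega) (by omega)
  by_cases h1 : k = i
  · subst h1; simp [artin_self, artin_succ, e1, e2, mul_assoc]
  by_cases h2 : k = i + 1
  · subst h2; simp [artin_self, artin_succ, e1, e2, mul_assoc]
  by_cases h3 : k = i + 1 + 1
  · subst h3; simp [artin_self, artin_succ, e1, e2, mul_assoc]
  simp [artin_other, h1, h2, h3]

lemma rels_hold {m : ℕ} {G : Type*} [Group G] (f : ℕ → G)
    (hc : ∀ i j, i + 2 ≤ j → j < m → f i * f j = f j * f i)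
    (hb : ∀ i, i + 1 < m → f i * f (i + 1) * f i = f (i + 1) * f i * f (i + 1)) :
    ∀ r ∈ braidRels m, FreeGroup.lift (fun j : Fin m => f j) r = 1 := by
  rintro r (⟨i, j, hij, rfl⟩ | ⟨i, j, hij, rfl⟩)
  · have := hc i j hij j.2
    simp [this]
  · have := hb i (by have := j.2; omega)
    simp only [map_mul, map_inv, FreeGroup.lift_apply_of, hij]
    rw [this, mul_inv_cancel]

/-- The hom out of the braid group given by a family satisfying the relations. -/
def M {m : ℕ} {G : Type*} [Group G] (f : ℕ → G)
    (hc : ∀ i j, i + 2 ≤ j → j < m → f i * f j = f j * f i)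
    (hb : ∀ i, i + 1 < m → f i * f (i + 1) * f i = f (i + 1) * f i * f (i + 1)) :
    PresentedGroup (braidRels m) →* G :=
  PresentedGroup.toGroup (rels_hold f hc hb)

lemma M_S {m : ℕ} {G : Type*} [Group G] (f : ℕ → G)
    (hc : ∀ i j, i + 2 ≤ j → j < m → f i * f j = f j * f i)
    (hb : ∀ i, i + 1 < m → f i * f (i + 1) * f i = f (i + 1) * f i * f (i + 1))
    {i : ℕ} (h : i < m) : M f hc hb (S m i) = f i := by
  simp [M, S, h]

lemma S_comm {m i j : ℕ} (h : i + 2 ≤ j) : S m i * S m j = S m j * S m i := by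
  by_cases hj : j < m
  · have hi : i < m := by omega
    have : (PresentedGroup.mk (braidRels m)) (FreeGroup.of ⟨i, hi⟩ * FreeGroup.of ⟨j, hj⟩ *
        (FreeGroup.of ⟨i, hi⟩)⁻¹ * (FreeGroup.of ⟨j, hj⟩)⁻¹) = 1 :=
      PresentedGroup.one_of_mem (Or.inl ⟨⟨i, hi⟩, ⟨j, hj⟩, h, rfl⟩)
    simp only [map_mul, map_inv] at this
    simp only [S, hi, hj, dif_pos]
    exact mul_inv_eq_iff_eq_mul.mp (mul_inv_eq_one.mp this)
  · simp [S_out (not_lt.mp hj)]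

lemma S_braid {m i : ℕ} (h : i + 1 < m) :
    S m i * S m (i + 1) * S m i = S m (i + 1) * S m i * S m (i + 1) := by
  have hi : i < m := by omega
  have : (PresentedGroup.mk (braidRels m)) (FreeGroup.of ⟨i, hi⟩ * FreeGroup.of ⟨i + 1, h⟩ *
      FreeGroup.of ⟨i, hi⟩ *
      (FreeGroup.of ⟨i + 1, h⟩ * FreeGroup.of ⟨i, hi⟩ * FreeGroup.of ⟨i + 1, h⟩)⁻¹) = 1 :=
    PresentedGroup.one_of_mem (Or.inr ⟨⟨i, hi⟩, ⟨i + 1, h⟩, rfl, rfl⟩)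
  simp only [map_mul, map_inv] at this
  simp only [S, hi, h, dif_pos]
  exact mul_inv_eq_one.mp this

lemma braid_induction {m : ℕ} {P : PresentedGroup (braidRels m) → Prop} (h1 : P 1)
    (hS : ∀ j x, j < m → P x → P (x * S m j)) (hi : ∀ j x, j < m → P x → P (x * (S m j)⁻¹))
    (x : PresentedGroup (braidRels m)) : P x := by
  have hx : x ∈ Subgroup.closure (Set.range (PresentedGroup.of (rels := braidRels m))) := by
    rw [PresentedGroup.closure_range_of]; trivial
  induction hx using Subgroup.closure_induction_right with
  | one => exact h1
  | mul_right x hx y hy ih =>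
    obtain ⟨j, rfl⟩ := hy
    rw [S_fin]; exact hS _ _ j.2 ih
  | mul_inv_cancel x hx y hy ih =>
    obtain ⟨j, rfl⟩ := hy
    rw [S_fin]; exact hi _ _ j.2 ih

/-- The `ℕ`-indexed family of Artin automorphisms. -/
def AF (m i : ℕ) : MulAut (FreeGroup (Fin (m + 1))) :=
  if h : i + 1 < m + 1 then artin (m + 1) i h else 1

lemma AF_pos {m i : ℕ} (h : i + 1 < m + 1) : AF m i = artin (m + 1) i h := by simp [AF, h]

/-- The Artin action of the braid group on `m + 1` strands. -/
def A (m : ℕ) : PresentedGroup (braidRels m) →* MulAut (FreeGroup (Fin (m + 1))) :=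
  M (AF m)
    (fun i j hij hj => by
      rw [AF_pos (show i + 1 < m + 1 by omega), AF_pos (show j + 1 < m + 1 by omega)]
      exact artin_comm _ _ hij)
    (fun i hi => by
      rw [AF_pos (show i + 1 < m + 1 by omega), AF_pos (show i + 1 + 1 < m + 1 by omega)]
      exact artin_braid _ _)

lemma A_S {m i : ℕ} (h : i < m) : A m (S m i) = artin (m + 1) i (by omega) := by
  rw [A, M_S _ _ _ h, AF_pos]

/-- Adding a strand. -/
def iota (m : ℕ) : PresentedGroup (braidRels m) →* PresentedGroup (braidRels (m + 1)) :=
  M (S (m + 1)) (fun _ _ hij _ => S_comm hij) (fun _ hi => S_braid (by omega))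

lemma iota_S {m i : ℕ} (h : i < m) : iota m (S m i) = S (m + 1) i := M_S _ _ _ h

/-- Killing the last free generator. -/
def pr (m : ℕ) : FreeGroup (Fin (m + 1 + 1)) →* FreeGroup (Fin (m + 1)) := L _ (X (m + 1))

lemma pr_X {m j : ℕ} : pr m (X (m + 1 + 1) j) = X (m + 1) j := by
  by_cases h : j < m + 1 + 1
  · exact L_X _ h
  · rw [X_out (by omega), X_out (by omega), map_one]

lemma pr_artin {m i : ℕ} (h : i < m) (y : FreeGroup (Fin (m + 1 + 1))) :
    pr m (artin (m + 1 + 1) i (by omega) y) = artin (m + 1) i (by omega) (pr m y) := by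
  have : (pr m).comp (artin (m + 1 + 1) i (by omega)).toMonoidHom =
      (artin (m + 1) i (by omega)).toMonoidHom.comp (pr m) := by
    apply hom_ext
    intro j hj
    change pr m (artin (m + 1 + 1) i (by omega) (X _ j)) =
      artin (m + 1) i (by omega) (pr m (X _ j))
    by_cases h1 : j = i
    · subst h1; simp [artin_self, pr_X]
    by_cases h2 : j = i + 1
    · subst h2; simp [artin_succ, pr_X]
    simp [artin_other, h1, h2, pr_X]
  exact DFunLike.congr_fun this y

lemma pr_A {m : ℕ} (b : PresentedGroup (braidRels m)) :
    ∀ y, pr m (A (m + 1) (iota m b) y) = A m b (pr m y) := by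
  induction b using braid_induction with
  | h1 => simp
  | hS j x hj ih =>
    intro y
    rw [map_mul, map_mul, map_mul, MulAut.mul_apply, MulAut.mul_apply, ih, iota_S hj, A_S hj,
      A_S (by omega), pr_artin hj]
  | hi j x hj ih =>
    intro y
    obtain ⟨z, rfl⟩ := (artin (m + 1 + 1) j (by omega)).surjective y
    rw [map_mul, map_mul, map_mul, MulAut.mul_apply, MulAut.mul_apply, ih, map_inv, map_inv,
      map_inv, iota_S hj, A_S hj,
      A_S (by omega), pr_artin hj]
    simp

lemma A_iota_last {m : ℕ} (b : PresentedGroup (braidRels m)) :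
    A (m + 1) (iota m b) (X (m + 1 + 1) (m + 1)) = X (m + 1 + 1) (m + 1) := by
  induction b using braid_induction with
  | h1 => simp
  | hS j x hj ih =>
    rw [map_mul, map_mul, MulAut.mul_apply, iota_S hj, 
      A_S (by omega), artin_other _ (by omega) (by omega), ih]
  | hi j x hj ih =>
    rw [map_mul, map_mul, MulAut.mul_apply, map_inv, map_inv, iota_S hj, 
      A_S (by omega)]
    have : (artin (m + 1 + 1) j (by omega))⁻¹ (X (m + 1 + 1) (m + 1)) = X (m + 1 + 1) (m + 1) := by
      rw [MulAut.inv_apply, MulEquiv.symm_apply_eq, artin_other _ (by omega) (by omega)]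
    rw [this, ih]

/-- Coset representatives, reversed indexing. -/
def cRev (m : ℕ) : ℕ → PresentedGroup (braidRels (m + 1))
  | 0 => 1
  | d + 1 => cRev m d * (S (m + 1) (m - d))⁻¹

/-- Coset representatives. -/
def c (m k : ℕ) : PresentedGroup (braidRels (m + 1)) := cRev m (m + 1 - k)

lemma c_top (m : ℕ) : c m (m + 1) = 1 := by simp [c, cRev]

lemma c_step {m k : ℕ} (h : k ≤ m) : c m k = c m (k + 1) * (S (m + 1) k)⁻¹ := by
  have e : m + 1 - k = (m + 1 - (k + 1)) + 1 := by omega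
  have ee : m - (m + 1 - (k + 1)) = k := by omega
  rw [c, e, cRev, ee, c]

lemma c_comm {m k i : ℕ} (hk : k ≤ m + 1) (h : i + 2 ≤ k) :
    S (m + 1) i * c m k = c m k * S (m + 1) i := by
  induction k, hk using dec_ind with
  | self => simp [c_top]
  | of_succ k hk ih =>
    have h1 := ih (by omega)
    rw [c_step (by omega), ← mul_assoc, h1, mul_assoc, mul_assoc]
    congr 1
    exact (Commute.inv_right (show Commute (S (m + 1) i) (S (m + 1) k) from S_comm h)).eq

lemma braid_aux {G : Type*} [Group G] {p q : G} (h : p * q * p = q * p * q) :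
    p * q⁻¹ * p⁻¹ = q⁻¹ * p⁻¹ * q := by
  rw [mul_inv_eq_iff_eq_mul, mul_inv_eq_iff_eq_mul]
  calc p = q⁻¹ * p⁻¹ * (p * q * p) := by group
    _ = q⁻¹ * p⁻¹ * q * p * q := by rw [h]; group

lemma c_shift {m k i : ℕ} (hk : k ≤ m + 1) (h : k ≤ i) (hi : i < m) :
    S (m + 1) i * c m k = c m k * S (m + 1) (i + 1) := by
  induction k, hk using dec_ind with
  | self => omega
  | of_succ k hk ih =>
    rcases Nat.lt_or_ge k i with hki | hki
    · have h1 := ih (by omega)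
      rw [c_step (by omega), ← mul_assoc, h1, mul_assoc, mul_assoc]
      congr 1
      exact (Commute.inv_left
        (show Commute (S (m + 1) k) (S (m + 1) (i + 1)) from S_comm (by omega))).eq.symm
    · obtain rfl : k = i := by omega
      have h1 := braid_aux (S_braid (show k + 1 < m + 1 by omega))
      have h2 := c_comm (m := m) (show k + 1 + 1 ≤ m + 1 by omega) (le_refl (k + 2))
      rw [c_step (by omega), c_step (k := k + 1) (by omega)]
      rw [← mul_assoc, ← mul_assoc, h2]
      simp only [mul_assoc] at h1 ⊢
      rw [h1]

/-- Pure braid generators. -/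
def a (m k : ℕ) : PresentedGroup (braidRels (m + 1)) :=
  c m (k + 1) * ((S (m + 1) k)⁻¹ * (S (m + 1) k)⁻¹) * (c m (k + 1))⁻¹

lemma conj_aux {G : Type*} [Group G] {s t d x : G} (h : s * d = d * t) :
    s * (d * x * d⁻¹) * s⁻¹ = d * (t * x * t⁻¹) * d⁻¹ := by
  have hs : s = d * t * d⁻¹ := by rw [← h]; group
  rw [hs]; group

lemma a_low {m i j : ℕ} (hj : j ≤ m) (h : i + 1 < j) :
    S (m + 1) i * a m j * (S (m + 1) i)⁻¹ = a m j := by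
  rw [a, conj_aux (c_comm (by omega) (by omega))]
  have : Commute (S (m + 1) i) (S (m + 1) j) := S_comm (by omega)
  rw [((this.inv_right).mul_right (this.inv_right)).eq]
  group

lemma a_high {m i j : ℕ} (h : j < i) (hi : i < m) :
    S (m + 1) i * a m j * (S (m + 1) i)⁻¹ = a m j := by
  rw [a, conj_aux (c_shift (by omega) (by omega) hi)]
  have : Commute (S (m + 1) (i + 1)) (S (m + 1) j) := (S_comm (by omega)).symm
  rw [((this.inv_right).mul_right (this.inv_right)).eq]
  group

lemma a_eq {m i : ℕ} (h : i < m) : a m i = c m (i + 2) * ((S (m + 1) (i + 1))⁻¹ *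
    ((S (m + 1) i)⁻¹ * (S (m + 1) i)⁻¹) * S (m + 1) (i + 1)) * (c m (i + 2))⁻¹ := by
  rw [a, c_step (k := i + 1) (by omega)]
  group

lemma braid_aux2 {G : Type*} [Group G] {p q : G} (h : p * q * p = q * p * q) :
    p * (q⁻¹ * q⁻¹) * p⁻¹ = q⁻¹ * (p⁻¹ * p⁻¹) * q := by
  have h1 := braid_aux h
  calc p * (q⁻¹ * q⁻¹) * p⁻¹ = (p * q⁻¹ * p⁻¹) * (p * q⁻¹ * p⁻¹) := by group
    _ = _ := by rw [h1]; group

lemma braid_aux3 {G : Type*} [Group G] {p q : G} (h : p * q * p = q * p * q) :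
    p * (q⁻¹ * (p⁻¹ * p⁻¹) * q) * p⁻¹ =
      (q⁻¹ * (p⁻¹ * p⁻¹) * q) * (q⁻¹ * q⁻¹) * (q⁻¹ * (p⁻¹ * p⁻¹) * q)⁻¹ := by
  have h1 := braid_aux h
  have h3 : q * p⁻¹ * q⁻¹ = p⁻¹ * q⁻¹ * p := braid_aux h.symm
  rw [eq_mul_inv_iff_mul_eq]
  calc p * (q⁻¹ * (p⁻¹ * p⁻¹) * q) * p⁻¹ * (q⁻¹ * (p⁻¹ * p⁻¹) * q)
      = p * (q⁻¹ * (p⁻¹ * p⁻¹) * q) * p⁻¹ * (p * (q⁻¹ * q⁻¹) * p⁻¹) := by rw [braid_aux2 h]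
    _ = (p * q⁻¹ * p⁻¹) * p⁻¹ * q⁻¹ * p⁻¹ := by group
    _ = q⁻¹ * p⁻¹ * (q * p⁻¹ * q⁻¹) * p⁻¹ := by rw [h1]; group
    _ = _ := by rw [h3]; group

lemma a_succ {m i : ℕ} (h : i < m) :
    S (m + 1) i * a m (i + 1) * (S (m + 1) i)⁻¹ = a m i := by
  rw [a, conj_aux (c_comm (by omega) (by omega)), a_eq h,
    braid_aux2 (S_braid (show i + 1 < m + 1 by omega))]

lemma a_self {m i : ℕ} (h : i < m) :
    S (m + 1) i * a m i * (S (m + 1) i)⁻¹ = a m i * a m (i + 1) * (a m i)⁻¹ := by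
  rw [a_eq h, conj_aux (c_comm (by omega) (by omega)),
    braid_aux3 (S_braid (show i + 1 < m + 1 by omega)), a]
  group

/-- The point-pushing map. -/
def alpha (m : ℕ) : FreeGroup (Fin (m + 1)) →* PresentedGroup (braidRels (m + 1)) :=
  L _ (a m)

lemma alpha_X {m j : ℕ} (h : j < m + 1) : alpha m (X (m + 1) j) = a m j := L_X _ h

lemma alpha_artin {m i : ℕ} (h : i < m) (x : FreeGroup (Fin (m + 1))) :
    alpha m (artin (m + 1) i (by omega) x) =
      S (m + 1) i * alpha m x * (S (m + 1) i)⁻¹ := by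
  have : (alpha m).comp (artin (m + 1) i (by omega)).toMonoidHom =
      (MulAut.conj (S (m + 1) i)).toMonoidHom.comp (alpha m) := by
    apply hom_ext
    intro j hj
    change alpha m (artin (m + 1) i (by omega) (X _ j)) =
      S (m + 1) i * alpha m (X _ j) * (S (m + 1) i)⁻¹
    rw [alpha_X hj]
    by_cases h1 : j = i
    · subst h1
      rw [a_self h, artin_self, map_mul, map_mul, map_inv, alpha_X hj, alpha_X (by omega)]
    by_cases h2 : j = i + 1
    · subst h2
      rw [a_succ h, artin_succ, alpha_X (by omega)]
    rw [artin_other _ h1 h2, alpha_X hj]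
    rcases Nat.lt_or_ge j i with h3 | h3
    · rw [a_high h3 h]
    · rw [a_low (by omega) (by omega)]
  exact DFunLike.congr_fun this x

/-- The shape of a decomposed braid. -/
def Dec (m : ℕ) (g : PresentedGroup (braidRels (m + 1))) : Prop :=
  ∃ b w k, k ≤ m + 1 ∧ g = iota m b * alpha m w * c m k

lemma slide {m i : ℕ} (h : i < m) (w : FreeGroup (Fin (m + 1))) :
    ∃ v, alpha m w * S (m + 1) i = S (m + 1) i * alpha m v := by
  refine ⟨(artin (m + 1) i (by omega))⁻¹ w, ?_⟩
  obtain ⟨z, rfl⟩ := (artin (m + 1) i (by omega)).surjective w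
  rw [alpha_artin h]
  simp

lemma slide_inv {m i : ℕ} (h : i < m) (w : FreeGroup (Fin (m + 1))) :
    ∃ v, alpha m w * (S (m + 1) i)⁻¹ = (S (m + 1) i)⁻¹ * alpha m v := by
  refine ⟨artin (m + 1) i (by omega) w, ?_⟩
  rw [alpha_artin h]
  group

lemma dec_slide {m i k : ℕ} (hk : k ≤ m + 1) (h : i < m) (b : PresentedGroup (braidRels m))
    (w : FreeGroup (Fin (m + 1))) :
    Dec m (iota m b * alpha m w * (S (m + 1) i * c m k)) := by
  obtain ⟨v, hv⟩ := slide h w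
  refine ⟨b * S m i, v, k, hk, ?_⟩
  rw [map_mul, iota_S h, mul_assoc (iota m b) (S (m + 1) i), ← hv]
  group

lemma dec_slide_inv {m i k : ℕ} (hk : k ≤ m + 1) (h : i < m) (b : PresentedGroup (braidRels m))
    (w : FreeGroup (Fin (m + 1))) :
    Dec m (iota m b * alpha m w * ((S (m + 1) i)⁻¹ * c m k)) := by
  obtain ⟨v, hv⟩ := slide_inv h w
  refine ⟨b * (S m i)⁻¹, v, k, hk, ?_⟩
  rw [map_mul, map_inv, iota_S h, mul_assoc (iota m b) (S (m + 1) i)⁻¹, ← hv]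
  group

lemma inv_swap {G : Type*} [Group G] {s t d : G} (h : s * d = d * t) :
    d * t⁻¹ = s⁻¹ * d := by
  rw [mul_inv_eq_iff_eq_mul, mul_assoc, ← h]; group

lemma dec_all {m : ℕ} (g : PresentedGroup (braidRels (m + 1))) : Dec m g := by
  induction g using braid_induction with
  | h1 => exact ⟨1, 1, m + 1, le_rfl, by simp [c_top]⟩
  | hS i x hi ih =>
    obtain ⟨b, w, k, hk, rfl⟩ := ih
    rw [mul_assoc]
    rcases lt_trichotomy i k with h | h | h
    · rcases Nat.lt_or_ge (i + 1) k with hh | hh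
      · rw [← c_comm hk (by omega)]
        exact dec_slide hk (by omega) b w
      · obtain rfl : k = i + 1 := by omega
        refine ⟨b, w * (X (m + 1) i)⁻¹, i, by omega, ?_⟩
        rw [map_mul, map_inv, alpha_X (by omega), a, c_step (show i ≤ m by omega)]
        group
    · subst h
      refine ⟨b, w, i + 1, by omega, ?_⟩
      rw [c_step (show i ≤ m by omega)]
      group
    · obtain ⟨i, rfl⟩ : ∃ ii, i = ii + 1 := ⟨i - 1, by omega⟩
      rw [← c_shift hk (by omega) (by omega)]
      exact dec_slide hk (by omega) b w
  | hi i x hi ih =>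
    obtain ⟨b, w, k, hk, rfl⟩ := ih
    rw [mul_assoc]
    rcases lt_trichotomy i k with h | h | h
    · rcases Nat.lt_or_ge (i + 1) k with hh | hh
      · rw [inv_swap (c_comm hk (by omega))]
        exact dec_slide_inv hk (by omega) b w
      · obtain rfl : k = i + 1 := by omega
        refine ⟨b, w, i, by omega, ?_⟩
        rw [c_step (show i ≤ m by omega)]
    · subst h
      refine ⟨b, w * X (m + 1) i, i + 1, by omega, ?_⟩
      rw [map_mul, alpha_X (by omega), a, c_step (show i ≤ m by omega)]
      group
    · obtain ⟨i, rfl⟩ : ∃ ii, i = ii + 1 := ⟨i - 1, by omega⟩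
      rw [inv_swap (c_shift hk (by omega) (by omega))]
      exact dec_slide_inv hk (by omega) b w

/-- Point-pushing acts trivially after killing the last generator, and conjugates the last
generator in a way that remembers the pushed loop. -/
def Q (m : ℕ) (w : FreeGroup (Fin (m + 1))) : Prop :=
  (∀ y, pr m (A (m + 1) (alpha m w) y) = pr m y) ∧
  ∃ W, pr m W = w ∧ A (m + 1) (alpha m w) (X (m + 1 + 1) (m + 1)) =
    W⁻¹ * X (m + 1 + 1) (m + 1) * W

lemma Q_one (m : ℕ) : Q m 1 := ⟨by simp, 1, by simp⟩

lemma Q_mul {m : ℕ} {v w : FreeGroup (Fin (m + 1))} (hv : Q m v) (hw : Q m w) :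
    Q m (v * w) := by
  obtain ⟨hv1, V, hV, hv2⟩ := hv
  obtain ⟨hw1, W, hW, hw2⟩ := hw
  refine ⟨fun y => by simp [hv1, hw1], V * A (m + 1) (alpha m v) W, by simp [hV, hW, hv1], ?_⟩
  simp [hw2, hv2, mul_assoc]

lemma Q_inv {m : ℕ} {v : FreeGroup (Fin (m + 1))} (hv : Q m v) : Q m v⁻¹ := by
  obtain ⟨hv1, V, hV, hv2⟩ := hv
  have h1 : ∀ y, pr m (A (m + 1) (alpha m v⁻¹) y) = pr m y := by
    intro y
    rw [← hv1, map_inv, map_inv, MulAut.apply_inv_self]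
  refine ⟨h1, (A (m + 1) (alpha m v⁻¹) V)⁻¹, by rw [map_inv (pr m), h1, hV], ?_⟩
  apply (A (m + 1) (alpha m v)).injective
  rw [map_inv, map_inv]
  simp [hv2, mul_assoc]

lemma Q_artin {m i : ℕ} (h : i < m) {v : FreeGroup (Fin (m + 1))} (hv : Q m v) :
    Q m (artin (m + 1) i (by omega) v) := by
  obtain ⟨hv1, V, hV, hv2⟩ := hv
  have hl : (artin (m + 1 + 1) i (by omega))⁻¹ (X (m + 1 + 1) (m + 1)) = X (m + 1 + 1) (m + 1) := by
    rw [MulAut.inv_apply, MulEquiv.symm_apply_eq, artin_other _ (by omega) (by omega)]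
  refine ⟨fun y => ?_, artin (m + 1 + 1) i (by omega) V, by rw [pr_artin h, hV], ?_⟩
  · rw [alpha_artin h, map_mul, map_mul, map_inv, A_S (by omega), MulAut.mul_apply,
      MulAut.mul_apply, pr_artin h, hv1, ← pr_artin h, MulAut.apply_inv_self]
  · rw [alpha_artin h, map_mul, map_mul, map_inv, A_S (by omega), MulAut.mul_apply,
      MulAut.mul_apply, hl, hv2, map_mul, map_mul, map_inv,
      artin_other (j := m + 1) _ (by omega) (by omega)]

lemma Q_base (m : ℕ) : Q m (X (m + 1) m) := by
  have e : A (m + 1) (alpha m (X (m + 1) m)) =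
      (artin (m + 1 + 1) m (by omega))⁻¹ * (artin (m + 1 + 1) m (by omega))⁻¹ := by
    rw [alpha_X (by omega), a, c_top]
    simp [A_S]
  have hx : X (m + 1) (m + 1) = 1 := X_out le_rfl
  constructor
  · have : (pr m).comp (A (m + 1) (alpha m (X (m + 1) m))).toMonoidHom = pr m := by
      apply hom_ext
      intro j hj
      change pr m (A (m + 1) (alpha m (X (m + 1) m)) (X _ j)) = pr m (X _ j)
      rw [e, MulAut.mul_apply]
      by_cases h1 : j = m
      · subst h1
        simp only [artin_inv_self, artin_inv_succ, map_mul, map_inv, pr_X, hx]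
        simp
      by_cases h2 : j = m + 1
      · subst h2
        simp only [artin_inv_self, artin_inv_succ, map_mul, map_inv, pr_X, hx]
        simp
      have : (artin (m + 1 + 1) m (by omega))⁻¹ (X (m + 1 + 1) j) = X (m + 1 + 1) j := by
        rw [MulAut.inv_apply, MulEquiv.symm_apply_eq, artin_other _ h1 h2]
      rw [this, this]
    exact fun y => DFunLike.congr_fun this y
  · refine ⟨(X (m + 1 + 1) (m + 1))⁻¹ * X (m + 1 + 1) m * X (m + 1 + 1) (m + 1), ?_, ?_⟩
    · simp [pr_X, hx]
    · rw [e, MulAut.mul_apply]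
      simp only [artin_inv_self, artin_inv_succ, map_mul, map_inv]

lemma Q_X {m j : ℕ} (h : j ≤ m) : Q m (X (m + 1) j) := by
  induction j, h using dec_ind with
  | self => exact Q_base m
  | of_succ k hk ih =>
    have := Q_artin hk ih
    rwa [artin_succ] at this

lemma Q_all {m : ℕ} (w : FreeGroup (Fin (m + 1))) : Q m w :=
  free_induction (Q_one m) (fun _ h => Q_X (by omega)) (fun _ => Q_inv) (fun _ _ => Q_mul) w

open Classical in
/-- Toggle the Boolean over the identity. -/
noncomputable def toggle (G : Type*) [Group G] : Equiv.Perm (G × Bool) :=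
  Function.Involutive.toPerm (fun p => if p.1 = 1 then (p.1, !p.2) else p) (by
    intro p
    obtain ⟨x, y⟩ := p
    by_cases h : x = 1 <;> simp [h])

open Classical in
lemma toggle_apply {G : Type*} [Group G] (p : G × Bool) :
    toggle G p = if p.1 = 1 then (p.1, !p.2) else p := rfl

/-- Left translation. -/
def leftTrans {G : Type*} [Group G] (g : G) : Equiv.Perm (G × Bool) :=
  Equiv.prodCongr (Equiv.mulLeft g) (Equiv.refl _)

/-- The wreath-type representation. -/
noncomputable def rho (m : ℕ) :
    FreeGroup (Fin (m + 1 + 1)) →* Equiv.Perm (FreeGroup (Fin (m + 1)) × Bool) :=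
  L _ fun j => if j = m + 1 then toggle _ else leftTrans (X (m + 1) j)

lemma rho_fst {m : ℕ} (y : FreeGroup (Fin (m + 1 + 1))) :
    ∀ p, (rho m y p).1 = pr m y * p.1 := by
  induction y using free_induction with
  | h1 => simp
  | hX j hj =>
    intro p
    rw [rho, L_X _ hj, pr_X]
    by_cases h : j = m + 1
    · subst h
      rw [X_out le_rfl]
      by_cases hh : p.1 = 1 <;> simp [toggle_apply, hh]
    · simp [h, leftTrans]
  | hi x ih =>
    intro p
    have := ih (rho m x⁻¹ p)
    rw [← Equiv.Perm.mul_apply, ← map_mul, mul_inv_cancel, map_one, Equiv.Perm.one_apply] at this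
    rw [this, map_inv (pr m), inv_mul_cancel_left]
  | hm x y hx hy => intro p; simp [hx, hy, mul_assoc]

lemma centralizer_pr {m : ℕ} {W : FreeGroup (Fin (m + 1 + 1))}
    (h : X (m + 1 + 1) (m + 1) = W⁻¹ * X (m + 1 + 1) (m + 1) * W) : pr m W = 1 := by
  by_contra hne
  have hh : W * X (m + 1 + 1) (m + 1) = X (m + 1 + 1) (m + 1) * W := by
    conv_lhs => rw [h]
    group
  have h2 := congrArg (fun f => rho m f (1, true)) hh
  have hr : rho m (X (m + 1 + 1) (m + 1)) = toggle _ := by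
    rw [rho, L_X _ (by omega)]; simp
  have h3 : (rho m W (1, true)).1 ≠ 1 := by rw [rho_fst]; simpa using hne
  simp only [map_mul, Equiv.Perm.mul_apply, hr] at h2
  have h4 : toggle _ (rho m W (1, true)) = rho m W (1, true) := by
    simp [toggle_apply, h3]
  rw [h4] at h2
  have h5 := (rho m W).injective h2
  simp [toggle_apply] at h5

lemma pr_c {m k : ℕ} (h : k ≤ m) :
    pr m (A (m + 1) (c m k) (X (m + 1 + 1) (m + 1))) = X (m + 1) m := by
  induction k, h using dec_ind with
  | self =>
    rw [c_step le_rfl, c_top, one_mul, map_inv, A_S (by omega), artin_inv_succ]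
    simp [pr_X, X_out (le_refl (m + 1))]
  | of_succ k hk ih =>
    have : (artin (m + 1 + 1) k (by omega))⁻¹ (X (m + 1 + 1) (m + 1)) = X (m + 1 + 1) (m + 1) := by
      rw [MulAut.inv_apply, MulEquiv.symm_apply_eq, artin_other _ (by omega) (by omega)]
    rw [c_step (by omega), map_mul, map_inv, A_S (by omega), MulAut.mul_apply, this, ih]

theorem A_injective (m : ℕ) : Function.Injective (A m) := by
  induction m with
  | zero =>
    intro x y _
    have h : ∀ z : PresentedGroup (braidRels 0), z = 1 := fun z => by
      induction z using braid_induction with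
      | h1 => rfl
      | hS j x hj ih => omega
      | hi j x hj ih => omega
    rw [h x, h y]
  | succ m ih =>
    rw [injective_iff_map_eq_one]
    intro g hg
    obtain ⟨b, w, k, hk, rfl⟩ := dec_all g
    obtain ⟨hw1, W, hW, hw2⟩ := Q_all w
    have key : ∀ y, A m b (pr m (A (m + 1) (c m k) y)) = pr m y := by
      intro y
      rw [← hw1, ← pr_A, ← MulAut.mul_apply, ← MulAut.mul_apply, ← map_mul, ← map_mul, hg,
        MulAut.one_apply]
    obtain rfl : k = m + 1 := by
      by_contra hne
      have h1 := key (X (m + 1 + 1) (m + 1))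
      rw [pr_c (by omega), pr_X, X_out le_rfl] at h1
      exact X_ne_one (show m < m + 1 by omega) ((MulEquiv.map_eq_one_iff _).mp h1)
    have hb : b = 1 := by
      apply ih
      rw [map_one]
      apply aut_ext
      intro j _
      have := key (X (m + 1 + 1) j)
      rwa [c_top, map_one, MulAut.one_apply, pr_X] at this
    subst hb
    rw [c_top, map_one, one_mul, mul_one] at hg ⊢
    rw [hg, MulAut.one_apply] at hw2
    have := centralizer_pr hw2
    rw [← hW, this, map_one]

end ArtinProof

/-- Artin's theorem: there is a group homomorphism `A : B_n → Aut(F_n)` determined on the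
generators by the Artin rules, and this homomorphism is injective (the action is faithful). -/
theorem artin_action_faithful (n : ℕ) :
    ∃ A : BraidGroup n →* MulAut (FreeGroup (Fin n)),
      IsArtinAction A ∧ Function.Injective A := by
  cases n with
  | zero =>
    refine ⟨1, fun i => i.elim0, fun x y _ => ?_⟩
    have h : ∀ z : PresentedGroup (braidRels 0), z = 1 := fun z => by
      induction z using ArtinProof.braid_induction with
      | h1 => rfl
      | hS j x hj ih => omega
      | hi j x hj ih => omega
    exact (h x).trans (h y).symm
  | succ m =>
    refine ⟨ArtinProof.A m, fun i => ?_, ArtinProof.A_injective m⟩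
    have hi : (i : ℕ) < m := i.2
    have e : ArtinProof.A m (braidGen (m + 1) i) =
        ArtinProof.artin (m + 1) i (by omega) := by
      rw [← ArtinProof.A_S hi, ← ArtinProof.S_fin]; rfl
    have e0 : FreeGroup.of (strand₀ i : Fin (m + 1)) = ArtinProof.X (m + 1) i :=
      ArtinProof.X_fin _
    have e1 : FreeGroup.of (strand₁ i : Fin (m + 1)) = ArtinProof.X (m + 1) (i + 1) :=
      ArtinProof.X_fin _
    refine ⟨?_, ?_, fun j h0 h1 => ?_⟩
    · rw [e, e0, e1, ArtinProof.artin_self]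
    · rw [e, e0, e1, ArtinProof.artin_succ]
    · rw [e, ArtinProof.X_fin, ArtinProof.artin_other]
      · exact fun h => h0 (Fin.ext h)
      · exact fun h => h1 (Fin.ext h)
end

section
/- Existence and uniqueness of Fox's free derivatives: let F_n be the free group on generators g_1,…,g_n and let ℤF_n denote its integral group ring. For each j ∈ {1,…,n} there exists a unique function ∂/∂g_j : F_n → ℤF_n satisfying ∂g_i/∂g_j = δ_{ij} (Kronecker delta, as an element of ℤF_n) for all i, and the product rule ∂(vw)/∂g_j = ∂v/∂g_j + v·(∂w/∂g_j) for all v, w ∈ F_n, where v acts by left multiplication in the group ring. -/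
/-- The affine permutation `x ↦ c + g x` of the group ring. -/
noncomputable def foxAffine {G : Type*} [Group G] (c : MonoidAlgebra ℤ G) (g : G) :
    Equiv.Perm (MonoidAlgebra ℤ G) where
  toFun x := c + MonoidAlgebra.of ℤ G g * x
  invFun x := MonoidAlgebra.of ℤ G g⁻¹ * (x - c)
  left_inv x := by
    beta_reduce
    rw [add_sub_cancel_left, ← mul_assoc, ← map_mul, inv_mul_cancel, map_one, one_mul]
  right_inv x := by
    beta_reduce
    rw [← mul_assoc, ← map_mul, mul_inv_cancel, map_one, one_mul, add_sub_cancel]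

/-- Existence and uniqueness of Fox's free derivatives: for each generator index `j` of
the free group `F_n`, there is a unique map `∂/∂g_j : F_n → ℤF_n` with `∂g_i/∂g_j = δ_{ij}`
and satisfying the product rule `∂(vw)/∂g_j = ∂v/∂g_j + v·∂w/∂g_j`. -/
theorem fox_derivative_existsUnique (n : ℕ) (j : Fin n) :
    ∃! d : FreeGroup (Fin n) → MonoidAlgebra ℤ (FreeGroup (Fin n)),
      (∀ i : Fin n, d (FreeGroup.of i) = if i = j then 1 else 0) ∧
      (∀ v w : FreeGroup (Fin n),
        d (v * w) = d v + MonoidAlgebra.of ℤ (FreeGroup (Fin n)) v * d w) := by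
  let L : FreeGroup (Fin n) →* Equiv.Perm (MonoidAlgebra ℤ (FreeGroup (Fin n))) :=
    FreeGroup.lift fun i => foxAffine (if i = j then 1 else 0) (FreeGroup.of i)
  have hof : ∀ i x, L (FreeGroup.of i) x =
      (if i = j then 1 else 0) + MonoidAlgebra.of ℤ (FreeGroup (Fin n)) (FreeGroup.of i) * x := by
    intro i x
    simp only [L, FreeGroup.lift_apply_of]
    rfl
  have hL : ∀ v x, L v x = L v 0 + MonoidAlgebra.of ℤ (FreeGroup (Fin n)) v * x := by
    intro v
    induction v using FreeGroup.induction_on with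
    | C1 => intro x; rw [map_one, map_one]; simp
    | of i => intro x; rw [hof, hof, mul_zero, add_zero]
    | inv_of i ih =>
      intro x
      rw [map_inv, Equiv.Perm.inv_eq_iff_eq, ih, mul_add, ← add_assoc, ← ih,
        ← Equiv.Perm.mul_apply, mul_inv_cancel, Equiv.Perm.one_apply, zero_add, ← mul_assoc, ← map_mul, mul_inv_cancel, map_one,
        one_mul]
    | mul v w hv hw =>
      intro x
      rw [map_mul, Equiv.Perm.mul_apply, Equiv.Perm.mul_apply, hw x, hv, hv (L w 0), mul_add,
        map_mul, mul_assoc, add_assoc]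
  refine ⟨fun v => L v 0, ⟨fun i => ?_, fun v w => ?_⟩, ?_⟩
  · change L _ 0 = _
    rw [hof, mul_zero, add_zero]
  · change L _ 0 = L v 0 + _ * L w 0
    rw [map_mul, Equiv.Perm.mul_apply, hL]
  · rintro d ⟨h1, h2⟩
    have d1 : d 1 = 0 := by
      have h := h2 1 1
      rw [mul_one, map_one, one_mul] at h
      exact left_eq_add.mp h
    have key : ∀ v x, L v x = d v + MonoidAlgebra.of ℤ (FreeGroup (Fin n)) v * x := by
      intro v
      induction v using FreeGroup.induction_on with
      | C1 => intro x; rw [map_one, map_one, d1]; simp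
      | of i => intro x; rw [hof, h1]
      | inv_of i ih =>
        intro x
        rw [map_inv, Equiv.Perm.inv_eq_iff_eq, ih, mul_add, ← add_assoc, ← h2, mul_inv_cancel, d1,
          zero_add, ← mul_assoc, ← map_mul, mul_inv_cancel, map_one, one_mul]
      | mul v w hv hw =>
        intro x
        rw [map_mul, Equiv.Perm.mul_apply, hw x, hv, h2, mul_add, map_mul, mul_assoc, add_assoc]
    funext v
    change d v = L v 0
    rw [key, mul_zero, add_zero]
end

section
/- In the braid group B_3 with generators σ_1, σ_2, set L = σ_1 and R = σ_2^{-1}. Every element of B_3 which is a product of a nonempty finite word in the letters L and R containing at least one occurrence of L and at least one occurrence of R has infinite order in B_3. In particular, σ_1σ_2^{-1} has infinite order in B_3. -/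
/-- The element of `B_3` given by a word in the letters `L = σ_1` (encoded `true`) and
`R = σ_2⁻¹` (encoded `false`). -/
def LRword (w : List Bool) : BraidGroup 3 :=
  (w.map (fun b => if b then braidGen 3 0 else (braidGen 3 1)⁻¹)).prod

/-- Nonnegative entries, diagonal at least one. -/
def LRpos (M : Matrix.SpecialLinearGroup (Fin 2) ℤ) : Prop :=
  1 ≤ M.1 0 0 ∧ 0 ≤ M.1 0 1 ∧ 0 ≤ M.1 1 0 ∧ 1 ≤ M.1 1 1

lemma LRpos_mul {M N : Matrix.SpecialLinearGroup (Fin 2) ℤ} (hM : LRpos M) (hN : LRpos N) :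
    LRpos (M * N) ∧ M.1 0 1 ≤ (M * N).1 0 1 ∧ N.1 0 1 ≤ (M * N).1 0 1 := by
  obtain ⟨a, b, c, d⟩ := hM
  obtain ⟨a', b', c', d'⟩ := hN
  simp only [LRpos, Matrix.SpecialLinearGroup.coe_mul, Matrix.mul_apply, Fin.sum_univ_two]
  refine ⟨⟨?_, ?_, ?_, ?_⟩, ?_, ?_⟩ <;> nlinarith [mul_nonneg b c', mul_nonneg c b']

/-- Images of the generators in `SL(2,ℤ)`. -/
def LRimg (i : Fin (3 - 1)) : Matrix.SpecialLinearGroup (Fin 2) ℤ :=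
  if i = 0 then ⟨!![1, 1; 0, 1], by simp [Matrix.det_fin_two]⟩
  else ⟨!![1, 0; -1, 1], by simp [Matrix.det_fin_two]⟩

lemma LRimg_rels : ∀ r ∈ braidRels (3 - 1), FreeGroup.lift LRimg r = 1 := by
  rintro r (⟨i, j, h, rfl⟩ | ⟨i, j, h, rfl⟩)
  · have := j.isLt
    omega
  · have h1 : i = 0 := by
      have := j.isLt
      apply Fin.ext
      simp only [Fin.val_zero]
      omega
    have h2 : j = 1 := by
      subst h1
      apply Fin.ext
      simpa using h
    subst h1 h2
    simp only [map_mul, map_inv, FreeGroup.lift_apply_of]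
    rw [mul_inv_eq_one]
    ext a b
    simp only [Matrix.SpecialLinearGroup.coe_mul]
    fin_cases a <;> fin_cases b <;>
      simp [LRimg, Matrix.mul_apply, Fin.sum_univ_two]

/-- The homomorphism `B_3 → SL(2,ℤ)`. -/
def LRhom : BraidGroup 3 →* Matrix.SpecialLinearGroup (Fin 2) ℤ :=
  PresentedGroup.toGroup LRimg_rels

lemma LRhom_gen (i : Fin (3 - 1)) : LRhom (braidGen 3 i) = LRimg i :=
  PresentedGroup.toGroup.of LRimg_rels

lemma LRpos_one : LRpos 1 := by simp [LRpos]

lemma LRpos_L : LRpos (LRhom (braidGen 3 0)) ∧ 1 ≤ (LRhom (braidGen 3 0)).1 0 1 := by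
  rw [LRhom_gen]; simp [LRpos, LRimg]

lemma LRpos_R : LRpos (LRhom (braidGen 3 1)⁻¹) := by
  rw [map_inv, LRhom_gen]
  unfold LRpos
  rw [Matrix.SpecialLinearGroup.coe_inv, Matrix.adjugate_fin_two]
  simp [LRimg]

lemma LRpos_word (w : List Bool) :
    LRpos (LRhom (LRword w)) ∧ (true ∈ w → 1 ≤ (LRhom (LRword w)).1 0 1) := by
  induction w with
  | nil => simp [LRword, LRpos_one]
  | cons b w ih =>
    cases b with
    | true =>
      have e : LRword (true :: w) = braidGen 3 0 * LRword w := by simp [LRword]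
      rw [e, map_mul]
      have := LRpos_mul LRpos_L.1 ih.1
      exact ⟨this.1, fun _ => LRpos_L.2.trans this.2.1⟩
    | false =>
      have e : LRword (false :: w) = (braidGen 3 1)⁻¹ * LRword w := by simp [LRword]
      rw [e, map_mul]
      have := LRpos_mul LRpos_R ih.1
      refine ⟨this.1, fun h => (ih.2 (by simpa using h)).trans this.2.2⟩

lemma LRpos_pow {M : Matrix.SpecialLinearGroup (Fin 2) ℤ} (hM : LRpos M) (k : ℕ) :
    LRpos (M ^ k) := by
  induction k with
  | zero => simpa using LRpos_one
  | succ k ih => rw [pow_succ]; exact (LRpos_mul ih hM).1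

lemma LRword_infinite (w : List Bool) (hw : true ∈ w) (k : ℕ) (hk : 1 ≤ k) :
    LRword w ^ k ≠ 1 := by
  intro h
  obtain ⟨k, rfl⟩ := Nat.exists_eq_add_of_le' hk
  obtain ⟨h1, h2⟩ := LRpos_word w
  have h3 := (h2 hw).trans (LRpos_mul (LRpos_pow h1 k) h1).2.2
  rw [← pow_succ, ← map_pow, h, map_one] at h3
  simp at h3

/-- Every element of `B_3` represented by a word in `L = σ_1` and `R = σ_2⁻¹` containing
at least one `L` and at least one `R` has infinite order; in particular `σ_1 σ_2⁻¹`
has infinite order. -/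
theorem lr_word_infinite_order :
    (∀ w : List Bool, true ∈ w → false ∈ w →
        ∀ k : ℕ, 1 ≤ k → LRword w ^ k ≠ 1) ∧
    (∀ k : ℕ, 1 ≤ k → (braidGen 3 0 * (braidGen 3 1)⁻¹) ^ k ≠ 1) := by
  refine ⟨fun w hw _ k hk => LRword_infinite w hw k hk, fun k hk => ?_⟩
  have := LRword_infinite [true, false] (by simp) k hk
  simpa [LRword] using this
end

section
/- In the braid group B_3 with generators σ_1, σ_2, set L = σ_1 and R = σ_2^{-1}. Let w and v be finite words in the letters L and R, each containing at least one occurrence of L and at least one occurrence of R. Then the elements of B_3 represented by w and v are conjugate in B_3 if and only if v is a cyclic permutation of w (i.e. there exist words a, b with w = ab and v = ba). -/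
abbrev LRMat := Matrix (Fin 2) (Fin 2) ℤ

/-- The matrix of a letter. -/
def letMat (b : Bool) : LRMat := if b then !![1, 1; 0, 1] else !![1, 0; 1, 1]

/-- The matrix of a word. -/
def wMat : List Bool → LRMat
  | [] => 1
  | b :: w => letMat b * wMat w

theorem wMat_append (u v : List Bool) : wMat (u ++ v) = wMat u * wMat v := by
  induction u with
  | nil => simp [wMat]
  | cons b u ih => simp [wMat, ih, mul_assoc]

theorem wMat_cons_true (w : List Bool) : 
    wMat (true :: w) 0 0 = wMat w 0 0 + wMat w 1 0 ∧ wMat (true :: w) 0 1 = wMat w 0 1 + wMat w 1 1 ∧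
    wMat (true :: w) 1 0 = wMat w 1 0 ∧ wMat (true :: w) 1 1 = wMat w 1 1 := by
  simp [wMat, letMat, Matrix.mul_apply, Fin.sum_univ_two]

theorem wMat_cons_false (w : List Bool) : 
    wMat (false :: w) 0 0 = wMat w 0 0 ∧ wMat (false :: w) 0 1 = wMat w 0 1 ∧
    wMat (false :: w) 1 0 = wMat w 0 0 + wMat w 1 0 ∧
    wMat (false :: w) 1 1 = wMat w 0 1 + wMat w 1 1 := by
  simp [wMat, letMat, Matrix.mul_apply, Fin.sum_univ_two]

theorem wMat_det (w : List Bool) : 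
    wMat w 0 0 * wMat w 1 1 - wMat w 0 1 * wMat w 1 0 = 1 := by
  induction w with
  | nil => simp [wMat]
  | cons b w ih =>
    cases b
    · obtain ⟨h1, h2, h3, h4⟩ := wMat_cons_false w
      rw [h1, h2, h3, h4]; linarith
    · obtain ⟨h1, h2, h3, h4⟩ := wMat_cons_true w
      rw [h1, h2, h3, h4]; linarith

theorem wMat_nonneg (w : List Bool) : 
    1 ≤ wMat w 0 0 ∧ 1 ≤ wMat w 1 1 ∧ 0 ≤ wMat w 0 1 ∧ 0 ≤ wMat w 1 0 := by
  induction w with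
  | nil => simp [wMat]
  | cons b w ih =>
    cases b
    · obtain ⟨h1, h2, h3, h4⟩ := wMat_cons_false w
      rw [h1, h2, h3, h4]; omega
    · obtain ⟨h1, h2, h3, h4⟩ := wMat_cons_true w
      rw [h1, h2, h3, h4]; omega

theorem wMat_pos (w : List Bool) : 
    (true ∈ w → 1 ≤ wMat w 0 1) ∧ (false ∈ w → 1 ≤ wMat w 1 0) := by
  induction w with
  | nil => simp
  | cons b w ih =>
    have := wMat_nonneg w
    cases b
    · obtain ⟨h1, h2, h3, h4⟩ := wMat_cons_false w
      rw [h2, h3]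
      refine ⟨fun h => ih.1 (by simpa using h), fun _ => by omega⟩
    · obtain ⟨h1, h2, h3, h4⟩ := wMat_cons_true w
      rw [h2, h3]
      refine ⟨fun _ => by omega, fun h => ih.2 (by simpa using h)⟩

theorem wMat_ext {A B : LRMat} (h1 : A 0 0 = B 0 0) (h2 : A 0 1 = B 0 1) (h3 : A 1 0 = B 1 0)
    (h4 : A 1 1 = B 1 1) : A = B := by
  ext i j
  fin_cases i <;> fin_cases j <;> assumption

theorem wMat_inj (u v : List Bool) (h : wMat u = wMat v) : u = v := by
  induction u generalizing v with
  | nil =>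
    cases v with
    | nil => rfl
    | cons b v =>
      exfalso
      have a1 : (1 : ℤ) = wMat (b :: v) 0 0 := by rw [← h]; simp [wMat]
      have a2 : (0 : ℤ) = wMat (b :: v) 0 1 := by rw [← h]; simp [wMat]
      have a3 : (0 : ℤ) = wMat (b :: v) 1 0 := by rw [← h]; simp [wMat]
      have := wMat_nonneg v
      cases b
      · obtain ⟨h1, h2, h3, h4⟩ := wMat_cons_false v
        omega
      · obtain ⟨h1, h2, h3, h4⟩ := wMat_cons_true v
        omega
  | cons a u ih =>
    have nu := wMat_nonneg u
    have du := wMat_det u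
    cases v with
    | nil =>
      exfalso
      have a1 : wMat (a :: u) 0 0 = 1 := by rw [h]; simp [wMat]
      have a2 : wMat (a :: u) 0 1 = 0 := by rw [h]; simp [wMat]
      have a3 : wMat (a :: u) 1 0 = 0 := by rw [h]; simp [wMat]
      cases a
      · obtain ⟨h1, h2, h3, h4⟩ := wMat_cons_false u
        omega
      · obtain ⟨h1, h2, h3, h4⟩ := wMat_cons_true u
        omega
    | cons b v =>
      have nv := wMat_nonneg v
      have e1 := congrFun (congrFun h 0) 0
      have e2 := congrFun (congrFun h 0) 1
      have e3 := congrFun (congrFun h 1) 0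
      have e4 := congrFun (congrFun h 1) 1
      cases a <;> cases b
      · obtain ⟨h1, h2, h3, h4⟩ := wMat_cons_false u
        obtain ⟨k1, k2, k3, k4⟩ := wMat_cons_false v
        rw [ih v (wMat_ext (by omega) (by omega) (by omega) (by omega))]
      · obtain ⟨h1, h2, h3, h4⟩ := wMat_cons_false u
        obtain ⟨k1, k2, k3, k4⟩ := wMat_cons_true v
        omega
      · obtain ⟨h1, h2, h3, h4⟩ := wMat_cons_true u
        obtain ⟨k1, k2, k3, k4⟩ := wMat_cons_false v
        omega
      · obtain ⟨h1, h2, h3, h4⟩ := wMat_cons_true u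
        obtain ⟨k1, k2, k3, k4⟩ := wMat_cons_true v
        rw [ih v (wMat_ext (by omega) (by omega) (by omega) (by omega))]

theorem wMat_surj (n : ℕ) : ∀ a b c d : ℤ, 0 ≤ a → 0 ≤ b → 0 ≤ c → 0 ≤ d → a * d - b * c = 1 →
    a + b + c + d ≤ n → ∃ u, wMat u = !![a, b; c, d] := by
  induction n with
  | zero =>
    intro a b c d ha hb hc hd hdet hn
    exfalso
    have : a = 0 := by push_cast at hn; omega
    have : b = 0 := by push_cast at hn; omega
    subst a b; simp at hdet
  | succ n ih =>
    intro a b c d ha hb hc hd hdet hn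
    push_cast at hn
    by_cases h1 : c ≤ a ∧ d ≤ b
    · have hcd : 0 < c + d := by
        by_contra hh
        have : c = 0 := by omega
        have : d = 0 := by omega
        subst c d; simp at hdet
      obtain ⟨u, hu⟩ := ih (a - c) (b - d) c d (by omega) (by omega) hc hd (by linarith) (by omega)
      exact ⟨true :: u, by simp [wMat, hu, letMat]⟩
    by_cases h2 : a ≤ c ∧ b ≤ d
    · have hcd : 0 < a + b := by
        by_contra hh
        have : a = 0 := by omega
        have : b = 0 := by omega
        subst a b; simp at hdet
      obtain ⟨u, hu⟩ := ih a b (c - a) (d - b) ha hb (by omega) (by omega) (by linarith) (by omega)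
      exact ⟨false :: u, by simp [wMat, hu, letMat]⟩
    by_cases h3 : c < a
    · have h4 : b < d := by omega
      have h5 : (c + 1) * (b + 1) ≤ a * d := by
        apply mul_le_mul <;> omega
      have h6 : b = 0 := by nlinarith
      have h7 : c = 0 := by nlinarith
      subst b c
      have h8 : a = 1 := by nlinarith
      subst a
      have h9 : d = 1 := by linarith
      subst d
      exact ⟨[], by simp [wMat, Matrix.one_fin_two]⟩
    · exfalso
      have h4 : a ≤ c := by omega
      have h5 : d ≤ b := by omega
      have : a * d ≤ c * b := mul_le_mul h4 h5 hd hc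
      linarith

/-- Columns become same-signed. -/
theorem col_lemma (w : List Bool) (M : LRMat) (j : Fin 2) :
    0 ≤ (wMat w * M) 0 j * (wMat w * M) 1 j ∨
    |(wMat w * M) 0 j| + |(wMat w * M) 1 j| + w.length ≤ |M 0 j| + |M 1 j| := by
  induction w with
  | nil => right; simp [wMat]
  | cons b w ih =>
    rw [wMat, mul_assoc]
    generalize wMat w * M = N at *
    have e : ∀ x y : ℤ, 0 ≤ x * y ↔ (0 ≤ x ∧ 0 ≤ y ∨ x ≤ 0 ∧ y ≤ 0) := fun x y => mul_nonneg_iff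
    simp only [e] at *
    cases b <;> simp [letMat, Matrix.mul_apply, Fin.sum_univ_two] <;>
    generalize N 0 j = x at * <;> generalize N 1 j = y at * <;>
    generalize |M 0 j| + |M 1 j| = K at * <;> grind

/-- Rows become same-signed. -/
theorem row_lemma (w : List Bool) (M : LRMat) (i : Fin 2) :
    0 ≤ (M * wMat w) i 0 * (M * wMat w) i 1 ∨
    |(M * wMat w) i 0| + |(M * wMat w) i 1| + w.length ≤ |M i 0| + |M i 1| := by
  induction w using List.reverseRecOn with
  | nil => right; simp [wMat]
  | append_singleton w b ih =>
    rw [wMat_append, ← mul_assoc]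
    generalize M * wMat w = N at *
    have e : ∀ x y : ℤ, 0 ≤ x * y ↔ (0 ≤ x ∧ 0 ≤ y ∨ x ≤ 0 ∧ y ≤ 0) := fun x y => mul_nonneg_iff
    simp only [e] at *
    cases b <;> simp [wMat, letMat, Matrix.mul_apply, Fin.sum_univ_two] <;>
    generalize N i 0 = x at * <;> generalize N i 1 = y at * <;>
    generalize |M i 0| + |M i 1| = K at * <;> grind

theorem col_lemma' (w : List Bool) (M : LRMat) (j : Fin 2) (h : |M 0 j| + |M 1 j| ≤ w.length) :
    0 ≤ (wMat w * M) 0 j * (wMat w * M) 1 j := by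
  rcases col_lemma w M j with h' | h'
  · exact h'
  · have h1 := abs_nonneg ((wMat w * M) 0 j)
    have h2 := abs_nonneg ((wMat w * M) 1 j)
    have : (wMat w * M) 0 j = 0 := abs_eq_zero.1 (by omega)
    rw [this]; simp

theorem row_lemma' (w : List Bool) (M : LRMat) (i : Fin 2) (h : |M i 0| + |M i 1| ≤ w.length) :
    0 ≤ (M * wMat w) i 0 * (M * wMat w) i 1 := by
  rcases row_lemma w M i with h' | h'
  · exact h'
  · have h1 := abs_nonneg ((M * wMat w) i 0)
    have h2 := abs_nonneg ((M * wMat w) i 1)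
    have : (M * wMat w) i 0 = 0 := abs_eq_zero.1 (by omega)
    rw [this]; simp

/-- The `n`-th power of a word. -/
def wPow (w : List Bool) : ℕ → List Bool
  | 0 => []
  | n + 1 => wPow w n ++ w

theorem wPow_length (w : List Bool) (hw : w ≠ []) (n : ℕ) : n ≤ (wPow w n).length := by
  have := List.length_pos_iff.2 hw
  induction n with
  | zero => simp
  | succ n ih => simp [wPow]; omega

theorem wMat_wPow (w : List Bool) (n : ℕ) : wMat (wPow w n) = wMat w ^ n := by
  induction n with
  | zero => simp [wPow, wMat]
  | succ n ih => rw [wPow, wMat_append, ih, pow_succ]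

theorem free_conj (n : ℕ) : ∀ c w v : List Bool, v ≠ [] → c.length ≤ n → c ++ w = v ++ c →
    ∃ a b : List Bool, w = a ++ b ∧ v = b ++ a := by
  induction n with
  | zero =>
    intro c w v hv hc h
    have : c = [] := List.length_eq_zero_iff.1 (by omega)
    subst c
    exact ⟨w, [], by simp, by simpa using h.symm⟩
  | succ n ih =>
    intro c w v hv hc h
    have := List.length_pos_iff.2 hv
    rcases List.append_eq_append_iff.1 h with ⟨d, h1, h2⟩ | ⟨d, h1, h2⟩
    · exact ⟨d, c, h2, h1⟩
    · subst h1
      refine ih d w v hv (by simp at hc; omega) h2.symm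

theorem mat_conj (w v : List Bool) (hwL : true ∈ w) (hwR : false ∈ w) (hvL : true ∈ v)
    (C : LRMat) (hdet : C 0 0 * C 1 1 - C 0 1 * C 1 0 = 1)
    (h : C * wMat w = wMat v * C) : ∃ a b : List Bool, w = a ++ b ∧ v = b ++ a := by
  have hw0 : w ≠ [] := List.ne_nil_of_mem hwL
  have hv0 : v ≠ [] := List.ne_nil_of_mem hvL
  have hpow : ∀ n, C * wMat w ^ n = wMat v ^ n * C := fun n =>
    (SemiconjBy.pow_right (show SemiconjBy C (wMat w) (wMat v) from h) n)
  obtain ⟨n, hn⟩ : ∃ n : ℕ, (n : ℤ) = |C 0 0| + |C 0 1| + |C 1 0| + |C 1 1| :=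
    ⟨(|C 0 0| + |C 0 1| + |C 1 0| + |C 1 1|).toNat, Int.toNat_of_nonneg (by positivity)⟩
  have p1 := abs_nonneg (C 0 0)
  have p2 := abs_nonneg (C 0 1)
  have p3 := abs_nonneg (C 1 0)
  have p4 := abs_nonneg (C 1 1)
  have lw := wPow_length w hw0 n
  have lv := wPow_length v hv0 n
  have lv' := wPow_length v hv0 (n + 1)
  have r0 := row_lemma' (wPow w n) C 0 (by omega)
  have r1 := row_lemma' (wPow w n) C 1 (by omega)
  have c0 := col_lemma' (wPow v n) C 0 (by omega)
  have c1 := col_lemma' (wPow v n) C 1 (by omega)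
  have d0 := col_lemma' (wPow v (n + 1)) C 0 (by omega)
  rw [wMat_wPow, ← hpow, pow_succ, ← mul_assoc] at d0
  rw [wMat_wPow, ← hpow] at c0 c1
  rw [wMat_wPow] at r0 r1
  have hM : (C * wMat w ^ n) * wMat w = wMat v * (C * wMat w ^ n) := by
    rw [mul_assoc, ← pow_succ, hpow, pow_succ', mul_assoc, hpow]
  have hMdet : (C * wMat w ^ n) 0 0 * (C * wMat w ^ n) 1 1
      - (C * wMat w ^ n) 0 1 * (C * wMat w ^ n) 1 0 = 1 := by
    rw [← Matrix.det_fin_two, Matrix.det_mul, ← wMat_wPow, Matrix.det_fin_two C, hdet,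
      Matrix.det_fin_two, wMat_det, one_mul]
  generalize C * wMat w ^ n = M at *
  have key : ∀ M : LRMat, 0 ≤ M 0 0 → 0 ≤ M 0 1 → 0 ≤ M 1 0 → 0 ≤ M 1 1 →
      M 0 0 * M 1 1 - M 0 1 * M 1 0 = 1 → M * wMat w = wMat v * M →
      ∃ a b : List Bool, w = a ++ b ∧ v = b ++ a := by
    intro M h1 h2 h3 h4 h5 h6
    obtain ⟨c, hc⟩ := wMat_surj (M 0 0 + M 0 1 + M 1 0 + M 1 1).toNat _ _ _ _ h1 h2 h3 h4 h5
      (by omega)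
    rw [← Matrix.eta_fin_two M] at hc
    rw [← hc, ← wMat_append, ← wMat_append] at h6
    exact free_conj _ c w v hv0 le_rfl (wMat_inj _ _ h6)
  have nw := wMat_nonneg w
  have q2 := (wMat_pos w).2 hwR
  have hMw0 : (M * wMat w) 0 0 = M 0 0 * wMat w 0 0 + M 0 1 * wMat w 1 0 := by
    simp [Matrix.mul_apply, Fin.sum_univ_two]
  have hMw1 : (M * wMat w) 1 0 = M 1 0 * wMat w 0 0 + M 1 1 * wMat w 1 0 := by
    simp [Matrix.mul_apply, Fin.sum_univ_two]
  rw [hMw0, hMw1] at d0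
  rcases lt_or_ge 0 (M 0 0 * M 1 1) with hp | hp
  · rcases mul_pos_iff.1 hp with ⟨ha, hd⟩ | ⟨ha, hd⟩
    · exact key M ha.le (nonneg_of_mul_nonneg_right r0 ha) (nonneg_of_mul_nonneg_right c0 ha) hd.le
        hMdet hM
    · refine key (-M) ?_ ?_ ?_ ?_ ?_ ?_
      · simp; omega
      · simp; nlinarith
      · simp; nlinarith
      · simp; omega
      · simpa using hMdet
      · simp [hM]
  · exfalso
    have hbc : M 0 1 * M 1 0 < 0 := by linarith
    have ha : M 0 0 = 0 := by
      by_contra hne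
      have : 0 < M 0 0 * M 0 0 := mul_self_pos.2 hne
      nlinarith [mul_nonneg r0 c0]
    rw [ha] at d0 hMdet
    have hd : M 1 1 = 0 := by
      by_contra hne
      have : 0 < M 1 1 * M 1 1 := mul_self_pos.2 hne
      nlinarith [mul_nonneg r1 c1]
    rw [hd] at d0
    have : 0 < wMat w 1 0 * wMat w 0 0 := mul_pos (by omega) (by omega)
    nlinarith

/-- Images of the generators in `SL(2, ℤ)`. -/
def slGen (i : Fin 2) : Matrix.SpecialLinearGroup (Fin 2) ℤ :=
  if i = 0 then ⟨!![1, 1; 0, 1], by simp⟩ else ⟨!![1, 0; -1, 1], by simp⟩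

theorem slGen_zero : (slGen 0 : LRMat) = !![1, 1; 0, 1] := rfl

theorem slGen_one : (slGen 1 : LRMat) = !![1, 0; -1, 1] := rfl

theorem slGen_rels : ∀ r ∈ braidRels 2, FreeGroup.lift slGen r = 1 := by
  rintro r (⟨i, j, hij, rfl⟩ | ⟨i, j, hij, rfl⟩)
  · omega
  · have hi : i = 0 := by omega
    have hj : j = 1 := by omega
    subst hi hj
    simp only [map_mul, map_inv, FreeGroup.lift_apply_of]
    rw [mul_inv_eq_one]
    apply Subtype.ext
    rw [Matrix.SpecialLinearGroup.coe_mul, Matrix.SpecialLinearGroup.coe_mul,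
      Matrix.SpecialLinearGroup.coe_mul, Matrix.SpecialLinearGroup.coe_mul]
    erw [slGen_zero, slGen_one]
    simp

/-- The homomorphism `B_3 → SL(2, ℤ)`. -/
def braidHom : BraidGroup 3 →* Matrix.SpecialLinearGroup (Fin 2) ℤ :=
  PresentedGroup.toGroup (rels := braidRels 2) slGen_rels

theorem LRword_cons (b : Bool) (w : List Bool) :
    LRword (b :: w) = (if b then braidGen 3 0 else (braidGen 3 1)⁻¹) * LRword w := by
  simp [LRword]

theorem LRword_append (u v : List Bool) : LRword (u ++ v) = LRword u * LRword v := by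
  simp [LRword]

theorem braidHom_gen (i : Fin 2) : braidHom (braidGen 3 i) = slGen i :=
  PresentedGroup.toGroup.of slGen_rels

theorem braidHom_word (w : List Bool) : (braidHom (LRword w) : LRMat) = wMat w := by
  induction w with
  | nil => simp [LRword, wMat]
  | cons b w ih =>
    rw [LRword_cons, map_mul, Matrix.SpecialLinearGroup.coe_mul, ih, wMat]
    congr 1
    cases b
    · simp only [Bool.false_eq_true, if_false, map_inv]
      erw [braidHom_gen 1]
      rw [Matrix.SpecialLinearGroup.coe_inv, slGen_one]
      simp [letMat, Matrix.adjugate_fin_two]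
    · simp only [if_true]
      erw [braidHom_gen 0]
      simp [slGen, letMat]

/-- Two words in the letters `L = σ_1`, `R = σ_2⁻¹`, each containing at least one `L`
and one `R`, represent conjugate elements of `B_3` if and only if one is a cyclic
permutation of the other. -/
theorem lr_word_conj_iff_cyclic_perm (w v : List Bool)
    (hwL : true ∈ w) (hwR : false ∈ w) (hvL : true ∈ v) (hvR : false ∈ v) :
    IsConj (LRword w) (LRword v) ↔ ∃ a b : List Bool, w = a ++ b ∧ v = b ++ a := by
  constructor
  · intro h
    obtain ⟨c, hc⟩ := isConj_iff.1 h
    have h1 : c * LRword w = LRword v * c := by rw [← hc]; group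
    have h2 := congrArg (fun g => (braidHom g : LRMat)) h1
    simp only [map_mul, Matrix.SpecialLinearGroup.coe_mul, braidHom_word] at h2
    refine mat_conj w v hwL hwR hvL _ ?_ h2
    rw [← Matrix.det_fin_two]
    exact (braidHom c).2
  · rintro ⟨a, b, rfl, rfl⟩
    rw [isConj_iff]
    refine ⟨(LRword a)⁻¹, ?_⟩
    rw [LRword_append, LRword_append]
    group
end

section
/- For all n ≥ 1 and m ≥ 0, the natural homomorphism from the braid group B_n to the braid group B_{n+m} which sends the generator σ_i of B_n to the generator σ_i of B_{n+m} for each i = 1,…,n−1 is injective. -/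
/-- Generators of the braid group indexed by `ℕ`, trivial out of range. -/
def bgen (k i : ℕ) : PresentedGroup (braidRels k) :=
  if h : i < k then PresentedGroup.of ⟨i, h⟩ else 1

theorem bgen_comm {k i j : ℕ} (hij : i + 2 ≤ j) (hj : j < k) :
    bgen k i * bgen k j = bgen k j * bgen k i := by
  have h : (PresentedGroup.mk (braidRels k)) (FreeGroup.of ⟨i, by omega⟩ * FreeGroup.of ⟨j, hj⟩ *
      (FreeGroup.of ⟨i, by omega⟩)⁻¹ * (FreeGroup.of ⟨j, hj⟩)⁻¹) = 1 :=
    PresentedGroup.one_of_mem (Or.inl ⟨⟨i, by omega⟩, ⟨j, hj⟩, hij, rfl⟩)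
  simp only [map_mul, map_inv] at h
  have hi : i < k := by omega
  simp only [bgen, hi, hj, dif_pos]
  exact mul_inv_eq_iff_eq_mul.mp (mul_inv_eq_one.mp h)

theorem bgen_braid {k i : ℕ} (hj : i + 1 < k) :
    bgen k i * (bgen k (i + 1) * bgen k i) = bgen k (i + 1) * (bgen k i * bgen k (i + 1)) := by
  have h : (PresentedGroup.mk (braidRels k)) (FreeGroup.of ⟨i, by omega⟩ *
      FreeGroup.of ⟨i + 1, hj⟩ * FreeGroup.of ⟨i, by omega⟩ *
      (FreeGroup.of ⟨i + 1, hj⟩ * FreeGroup.of ⟨i, by omega⟩ * FreeGroup.of ⟨i + 1, hj⟩)⁻¹) = 1 :=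
    PresentedGroup.one_of_mem (Or.inr ⟨⟨i, by omega⟩, ⟨i + 1, hj⟩, rfl, rfl⟩)
  rw [map_mul, map_inv, mul_inv_eq_one] at h
  simp only [map_mul] at h
  have hi : i < k := by omega
  simp only [bgen, hi, hj, dif_pos, ← mul_assoc]
  exact h

/-- New position of the forgotten strand. -/
def posAct (i p : ℕ) : ℕ := if p = i then i + 1 else if p = i + 1 then i else p

/-- Letter emitted when crossing `i` is applied with the forgotten strand at `p`. -/
def letter (k i p : ℕ) : PresentedGroup (braidRels k) :=
  if p = i ∨ p = i + 1 ∨ k + 1 < p then 1 else if p < i then bgen k (i - 1) else bgen k i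

theorem posAct_posAct (i p : ℕ) : posAct i (posAct i p) = p := by
  unfold posAct; split_ifs <;> omega

/-- Action of the `i`-th generator, forgetting one strand. -/
def strandPerm (k i : ℕ) : Equiv.Perm (ℕ × PresentedGroup (braidRels k)) where
  toFun x := (posAct i x.1, letter k i x.1 * x.2)
  invFun x := (posAct i x.1, (letter k i (posAct i x.1))⁻¹ * x.2)
  left_inv x := by simp [posAct_posAct]
  right_inv x := by simp [posAct_posAct]

theorem strandPerm_comm {k i j : ℕ} (hij : i + 2 ≤ j) (hj : j ≤ k) :
    strandPerm k i * strandPerm k j =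
      strandPerm k j * strandPerm k i := by
  ext1 ⟨p, g⟩
  simp only [strandPerm, Equiv.Perm.mul_apply, Equiv.coe_fn_mk, ← mul_assoc]
  refine Prod.ext ?_ ?_
  · simp only [posAct]; split_ifs <;> omega
  · refine congrArg (· * g) ?_
    by_cases h0 : k + 1 < p
    · have h1 : posAct i p = p := by simp only [posAct]; split_ifs <;> omega
      have h2 : posAct j p = p := by simp only [posAct]; split_ifs <;> omega
      simp [h1, h2, letter, h0]
    have key1 : p < i → bgen k (i - 1) * bgen k (j - 1) = bgen k (j - 1) * bgen k (i - 1) :=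
      fun _ => bgen_comm (by omega) (by omega)
    have key2 : i + 1 < p → p < j → bgen k i * bgen k (j - 1) = bgen k (j - 1) * bgen k i :=
      fun _ _ => bgen_comm (by omega) (by omega)
    have key3 : j + 1 < p → bgen k i * bgen k j = bgen k j * bgen k i :=
      fun _ => bgen_comm (by omega) (by omega)
    simp only [posAct, letter]
    split_ifs <;> first
      | omega
      | (simp only [one_mul, mul_one]; done)
      | exact key1 (by omega)
      | exact key2 (by omega) (by omega)
      | exact key3 (by omega)

theorem strandPerm_braid {k i : ℕ} (hj : i + 1 ≤ k) :
    strandPerm k i * strandPerm k (i + 1) * strandPerm k i =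
      strandPerm k (i + 1) * strandPerm k i * strandPerm k (i + 1) := by
  ext1 ⟨p, g⟩
  simp only [strandPerm, Equiv.Perm.mul_apply, Equiv.coe_fn_mk]
  refine Prod.ext ?_ ?_
  · simp only [posAct]; split_ifs <;> omega
  · simp only [← mul_assoc]
    refine congrArg (· * g) ?_
    simp only [mul_assoc]
    rcases lt_or_ge (k + 1) p with h0 | h0
    · have h1 : posAct i p = p := by simp only [posAct]; split_ifs <;> omega
      have h2 : posAct (i + 1) p = p := by simp only [posAct]; split_ifs <;> omega
      simp [h1, h2, letter, h0]
    rcases lt_or_ge p i with h | h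
    · obtain ⟨l, rfl⟩ : ∃ l, i = l + 1 := ⟨i - 1, by omega⟩
      have h1 : posAct (l + 1) p = p := by simp only [posAct]; split_ifs <;> omega
      have h2 : posAct (l + 1 + 1) p = p := by simp only [posAct]; split_ifs <;> omega
      have h3 : letter k (l + 1) p = bgen k l := by
        simp only [letter]; split_ifs <;> first | omega | rfl
      have h4 : letter k (l + 1 + 1) p = bgen k (l + 1) := by
        simp only [letter]; split_ifs <;> first | omega | rfl
      simp only [h1, h2, h3, h4]
      exact bgen_braid (by omega)
    rcases lt_or_ge (i + 2) p with h' | h'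
    · have h1 : posAct i p = p := by simp only [posAct]; split_ifs <;> omega
      have h2 : posAct (i + 1) p = p := by simp only [posAct]; split_ifs <;> omega
      have h3 : letter k i p = bgen k i := by
        simp only [letter]; split_ifs <;> first | omega | rfl
      have h4 : letter k (i + 1) p = bgen k (i + 1) := by
        simp only [letter]; split_ifs <;> first | omega | rfl
      simp only [h1, h2, h3, h4]
      exact bgen_braid (by omega)
    have a1 : posAct i i = i + 1 := by simp [posAct]
    have a2 : posAct i (i + 1) = i := by simp [posAct]
    have a3 : posAct i (i + 2) = i + 2 := by simp [posAct]
    have a4 : posAct (i + 1) i = i := by simp only [posAct]; split_ifs <;> omega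
    have a5 : posAct (i + 1) (i + 1) = i + 2 := by simp [posAct]
    have a6 : posAct (i + 1) (i + 2) = i + 1 := by simp [posAct]
    have l1 : letter k i i = 1 := by simp [letter]
    have l2 : letter k i (i + 1) = 1 := by simp [letter]
    have l3 : letter k i (i + 2) = bgen k i := by
      simp only [letter]; split_ifs <;> first | omega | rfl
    have l4 : letter k (i + 1) i = bgen k i := by
      simp only [letter]; split_ifs <;> first | omega | rfl
    have l5 : letter k (i + 1) (i + 1) = 1 := by simp [letter]
    have l6 : letter k (i + 1) (i + 2) = 1 := by simp [letter]
    have h3 : p = i ∨ p = i + 1 ∨ p = i + 2 := by omega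
    rcases h3 with rfl | rfl | rfl <;>
      simp only [a1, a2, a3, a4, a5, a6, l1, l2, l3, l4, l5, l6, one_mul, mul_one]

/-- The braid group on one more strand acts, forgetting a strand. -/
def forgetHom (k : ℕ) : PresentedGroup (braidRels (k + 1)) →*
    Equiv.Perm (ℕ × PresentedGroup (braidRels k)) :=
  PresentedGroup.toGroup (rels := braidRels (k + 1)) (f := fun i : Fin (k + 1) => strandPerm k i) (by
    rintro r (⟨i, j, hij, rfl⟩ | ⟨i, j, hij, rfl⟩)
    · simp only [map_mul, map_inv, FreeGroup.lift_apply_of]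
      rw [mul_inv_eq_one, mul_inv_eq_iff_eq_mul]
      exact strandPerm_comm hij (by omega)
    · obtain ⟨j, hj⟩ := j
      simp only at hij
      subst hij
      rw [map_mul, map_inv, mul_inv_eq_one]
      simp only [map_mul, FreeGroup.lift_apply_of]
      exact strandPerm_braid (by omega))

/-- The natural inclusion. -/
def stepHom (k : ℕ) : PresentedGroup (braidRels k) →* PresentedGroup (braidRels (k + 1)) :=
  PresentedGroup.toGroup (rels := braidRels k) (f := fun i : Fin k => bgen (k + 1) i) (by
    rintro r (⟨i, j, hij, rfl⟩ | ⟨i, j, hij, rfl⟩)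
    · simp only [map_mul, map_inv, FreeGroup.lift_apply_of]
      rw [mul_inv_eq_one, mul_inv_eq_iff_eq_mul]
      exact bgen_comm hij (by omega)
    · obtain ⟨j, hj⟩ := j
      simp only at hij
      subst hij
      rw [map_mul, map_inv, mul_inv_eq_one]
      simp only [map_mul, FreeGroup.lift_apply_of, mul_assoc]
      exact bgen_braid (by omega))

theorem stepHom_of (k : ℕ) (i : Fin k) :
    stepHom k (PresentedGroup.of i) = PresentedGroup.of (Fin.castLE (by omega) i) := by
  have hi : (i : ℕ) < k + 1 := by omega
  simp only [stepHom, PresentedGroup.toGroup.of, bgen, hi, dif_pos]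
  rfl

theorem forget_stepHom_of (k : ℕ) (i : Fin k) (g : PresentedGroup (braidRels k)) :
    forgetHom k (stepHom k (PresentedGroup.of i)) (k + 1, g) =
      (k + 1, PresentedGroup.of i * g) := by
  rw [stepHom_of]
  simp only [forgetHom, PresentedGroup.toGroup.of]
  have hi := i.isLt
  simp only [strandPerm, Equiv.coe_fn_mk, Fin.val_castLE]
  refine Prod.ext ?_ ?_
  · simp only [posAct]; split_ifs <;> omega
  · refine congrArg (· * g) ?_
    simp only [letter, bgen]; split_ifs <;> first | omega | rfl

theorem forget_stepHom (k : ℕ) (x : PresentedGroup (braidRels k)) :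
    ∀ g, forgetHom k (stepHom k x) (k + 1, g) = (k + 1, x * g) := by
  have hx : x ∈ Subgroup.closure (Set.range (PresentedGroup.of (rels := braidRels k))) := by
    rw [PresentedGroup.closure_range_of]; trivial
  induction hx using Subgroup.closure_induction with
  | mem x hx => obtain ⟨i, rfl⟩ := hx; exact forget_stepHom_of k i
  | one => intro g; simp
  | mul x y _ _ ihx ihy =>
    intro g
    rw [map_mul, map_mul, Equiv.Perm.mul_apply, ihy, ihx, mul_assoc]
  | inv x _ ih =>
    intro g
    rw [map_inv, map_inv, Equiv.Perm.inv_eq_iff_eq, ih, mul_inv_cancel_left]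

theorem stepHom_injective (k : ℕ) : Function.Injective (stepHom k) := by
  intro x y h
  have hx := forget_stepHom k x 1
  rw [h, forget_stepHom k y 1] at hx
  simpa using (congrArg Prod.snd hx).symm

theorem incl_injective (a b : ℕ) (hab : a ≤ b) :
    ∃ φ : PresentedGroup (braidRels a) →* PresentedGroup (braidRels b),
      (∀ i : Fin a, φ (PresentedGroup.of i) = PresentedGroup.of (Fin.castLE hab i)) ∧
      Function.Injective φ := by
  induction b, hab using Nat.le_induction with
  | base => exact ⟨MonoidHom.id _, fun i => rfl, fun _ _ h => h⟩
  | succ b hab ih =>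
    obtain ⟨φ, h1, h2⟩ := ih
    refine ⟨(stepHom b).comp φ, fun i => ?_, (stepHom_injective b).comp h2⟩
    rw [MonoidHom.comp_apply, h1, stepHom_of]
    rfl

/-- For `n ≥ 1` and `m ≥ 0`, the natural homomorphism `B_n → B_{n+m}` sending the
generator `σ_i` of `B_n` to the generator `σ_i` of `B_{n+m}` is injective. -/
theorem braid_inclusion_injective (n m : ℕ) (hn : 1 ≤ n) :
    ∃ φ : BraidGroup n →* BraidGroup (n + m),
      (∀ i : Fin (n - 1),
        φ (braidGen n i) = braidGen (n + m) (Fin.castLE (by omega) i)) ∧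
      Function.Injective φ := by
  exact incl_injective (n - 1) (n + m - 1) (by omega)
end
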